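/- For every natural number n ≥ 1 and every 1 ≤ i ≤ n, the left ideal ℚ[Sₙ]·ẽ⁽ⁱ⁾ₙ of the rational group algebra ℚ[Sₙ] has ℚ-dimension equal to the coefficient of q^i in the polynomial q(q+1)(q+2)⋯(q+n−1). -/

import Mathlib

noncomputable section

/-- Number of descents of a permutation of `Fin n`. -/
def descents {n : ℕ} (σ : Equiv.Perm (Fin n)) : ℕ :=
  (Finset.univ.filter fun p : Fin n × Fin n =>
    (p.2 : ℕ) = (p.1 : ℕ) + 1 ∧ σ p.2 < σ p.1).card

/-- `aCoeff n l j` is the coefficient of `X^l` in `(1/n!) ∏_{i=1}^n (X - j + i) ∈ ℚ[X]`. -/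
def aCoeff (n l j : ℕ) : ℚ :=
  (((n.factorial : ℚ))⁻¹ • ∏ i ∈ Finset.Icc 1 n,
    (Polynomial.X + Polynomial.C ((i : ℚ) - (j : ℚ)))).coeff l

/-- The Eulerian element `ẽ⁽ˡ⁾ₙ = Σ_{σ ∈ Sₙ} aₙ^{l, des σ + 1} · σ ∈ ℚ[Sₙ]`. -/
def eul (n l : ℕ) : MonoidAlgebra ℚ (Equiv.Perm (Fin n)) :=
  ∑ σ : Equiv.Perm (Fin n), MonoidAlgebra.single σ (aCoeff n l (descents σ + 1))

/-- The left ideal `ℚ[Sₙ]·ẽ⁽ⁱ⁾ₙ`, as the `ℚ`-span of `{x·ẽ⁽ⁱ⁾ₙ : x ∈ ℚ[Sₙ]}`. -/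
def leftIdeal (n i : ℕ) : Submodule ℚ (MonoidAlgebra ℚ (Equiv.Perm (Fin n))) :=
  Submodule.span ℚ {y | ∃ x : MonoidAlgebra ℚ (Equiv.Perm (Fin n)), y = x * eul n i}

lemma count_aux {m k : ℕ} (D : Fin m → Prop) [DecidablePred D] (c : Fin (m+1) → ℕ)
    (c0 : c 0 = 0) (cs : ∀ i : Fin m, c i.succ = c i.castSucc + if D i then 0 else 1) :
    (Finset.univ.filter fun a : Fin (m+1) → Fin k =>
      ∀ i : Fin m, a i.castSucc < a i.succ ∨ (a i.castSucc = a i.succ ∧ ¬ D i)).card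
      = (k + c (Fin.last m)).choose (m+1) := by
  classical
  have key : ∀ a : Fin (m+1) → Fin k,
      (∀ i : Fin m, a i.castSucc < a i.succ ∨ (a i.castSucc = a i.succ ∧ ¬ D i)) →
      StrictMono (fun i => (a i : ℕ) + c i) := by
    intro a ha
    rw [Fin.strictMono_iff_lt_succ]
    intro i
    have h := ha i
    have h2 := cs i
    rw [Fin.lt_def, Fin.ext_iff] at h

    split_ifs at h2 with h3
    · simp [h3] at h; omega
    · omega
  calc _ = (Finset.powersetCard (m+1) (Finset.range (k + c (Fin.last m)))).card := ?_
    _ = _ := by simp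
  refine Finset.card_bij (fun a _ => Finset.univ.image (fun i => (a i : ℕ) + c i)) ?_ ?_ ?_
  · intro a ha
    have hm := key a (by simpa using ha)
    rw [Finset.mem_powersetCard]
    refine ⟨?_, ?_⟩
    · intro x hx
      simp only [Finset.mem_image, Finset.mem_univ, true_and] at hx
      obtain ⟨i, rfl⟩ := hx
      have h1 := hm.monotone (Fin.le_last i)
      have h2 := (a (Fin.last m)).2

      rw [Finset.mem_range]; omega
    · rw [Finset.card_image_of_injective _ hm.injective]; simp
  · intro a ha b hb hab
    have hm := key a (by simpa using ha)
    have hm' := key b (by simpa using hb)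
    have : (fun i => (a i : ℕ) + c i) = (fun i => (b i : ℕ) + c i) := by
      rw [← hm.range_inj hm']
      have := congrArg (fun s : Finset ℕ => (s : Set ℕ)) hab
      simpa using this
    funext i
    have h := congrFun this i

    apply Fin.ext; omega
  · intro s hs
    rw [Finset.mem_powersetCard] at hs
    obtain ⟨hs, hc⟩ := hs
    set b := s.orderEmbOfFin hc with hb
    have hbm : StrictMono b := b.strictMono
    have hle : ∀ i, c i ≤ b i := by
      intro i
      induction i using Fin.induction with
      | zero => omega
      | succ i ih =>
        have h1 : b i.castSucc < b i.succ := hbm Fin.castSucc_lt_succ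
        have h2 := cs i
        split_ifs at h2 <;> omega
    have hmono : Monotone (fun i => b i - c i) := by
      rw [Fin.monotone_iff_le_succ]
      intro i
      have h1 : b i.castSucc < b i.succ := hbm Fin.castSucc_lt_succ
      have h2 := cs i
      have h3 := hle i.castSucc

      split_ifs at h2 <;> omega
    have hlt : ∀ i, b i - c i < k := by
      intro i
      have h1 := hmono (Fin.le_last i)
      have h2 := hs (s.orderEmbOfFin_mem hc (Fin.last m))
      rw [← hb, Finset.mem_range] at h2
      have h3 := hle (Fin.last m)
      simp only at h1
      omega
    refine ⟨fun i => ⟨b i - c i, hlt i⟩, ?_, ?_⟩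
    · simp only [Finset.mem_filter, Finset.mem_univ, true_and]
      intro i
      rw [Fin.lt_def, Fin.ext_iff]
      have h1 : b i.castSucc < b i.succ := hbm Fin.castSucc_lt_succ
      have h2 := cs i
      have h3 := hle i.castSucc
      have h4 := hle i.succ
      simp only
      split_ifs at h2 with h5
      · left; omega
      · simp only [h5, not_false_eq_true, and_true]; omega
    · have : (fun i => b i - c i + c i) = b := by
        funext i; have := hle i; omega
      simp only [this]
      rw [← Finset.coe_inj]
      simp [hb]

lemma eq_sort_iff_adj {m : ℕ} {α : Type*} [LinearOrder α] (f : Fin (m+1) → α)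
    (σ : Equiv.Perm (Fin (m+1))) :
    σ = Tuple.sort f ↔ ∀ i : Fin m, f (σ i.castSucc) < f (σ i.succ) ∨
      (f (σ i.castSucc) = f (σ i.succ) ∧ σ i.castSucc < σ i.succ) := by
  have h1 : σ = Tuple.sort f ↔ StrictMono (fun i => toLex (f (σ i), σ i)) := by
    rw [Tuple.eq_sort_iff']; rfl
  rw [h1, Fin.strictMono_iff_lt_succ]
  simp only [Prod.Lex.toLex_lt_toLex]

lemma descents_eq {m : ℕ} (σ : Equiv.Perm (Fin (m+1))) :
    descents σ = (Finset.univ.filter fun i : Fin m => σ i.succ < σ i.castSucc).card := by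
  symm
  unfold descents
  refine Finset.card_bij (fun i _ => (i.castSucc, i.succ)) ?_ ?_ ?_
  · intro i hi
    simpa using hi
  · intro i _ j _ h
    simpa using h
  · rintro ⟨p, q⟩ h
    simp only [Finset.mem_filter, Finset.mem_univ, true_and] at h
    obtain ⟨h1, h2⟩ := h
    have hp : (p : ℕ) < m := by have := q.2; omega
    have e1 : p = (⟨p, hp⟩ : Fin m).castSucc := rfl
    have e2 : q = (⟨p, hp⟩ : Fin m).succ := Fin.ext (by simpa using h1)
    refine ⟨⟨p, hp⟩, ?_, ?_⟩
    · simp only [Finset.mem_filter, Finset.mem_univ, true_and]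
      rw [← e1, ← e2]; exact h2
    · rw [← e1, ← e2]

lemma count_sort {m : ℕ} (k : ℕ) (σ : Equiv.Perm (Fin (m+1))) :
    (Finset.univ.filter fun w : Fin (m+1) → Fin k => Tuple.sort w = σ).card
      = (k + m - descents σ).choose (m+1) ∧ descents σ ≤ m := by
  set D : Fin m → Prop := fun i => σ i.succ < σ i.castSucc with hD
  set c : Fin (m+1) → ℕ := fun i =>
    (Finset.univ.filter fun p : Fin m => p.castSucc < i ∧ ¬ D p).card with hc
  have c0 : c 0 = 0 := by simp [hc]
  have cs : ∀ i : Fin m, c i.succ = c i.castSucc + if D i then 0 else 1 := by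
    intro i
    simp only [hc]
    by_cases h : D i
    · simp only [h, if_true, add_zero]
      congr 1
      ext p
      simp only [Finset.mem_filter, Finset.mem_univ, true_and, Fin.lt_def, Fin.val_succ,
        Fin.val_castSucc]
      constructor
      · rintro ⟨h1, h2⟩
        refine ⟨?_, h2⟩
        rcases Nat.lt_succ_iff_lt_or_eq.1 h1 with h3 | h3
        · exact h3
        · exact absurd ((Fin.ext h3 : p = i) ▸ h) h2
      · rintro ⟨h1, h2⟩
        exact ⟨by omega, h2⟩
    · simp only [h, if_false]
      rw [← Finset.card_insert_of_notMem (a := i)]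
      · congr 1
        ext p
        simp only [Finset.mem_filter, Finset.mem_univ, true_and, Fin.lt_def, Fin.val_succ,
          Fin.val_castSucc, Finset.mem_insert]
        constructor
        · rintro ⟨h1, h2⟩
          rcases Nat.lt_succ_iff_lt_or_eq.1 h1 with h3 | h3
          · exact Or.inr ⟨h3, h2⟩
          · exact Or.inl (Fin.ext h3)
        · rintro (rfl | ⟨h1, h2⟩)
          · exact ⟨by omega, h⟩
          · exact ⟨by omega, h2⟩
      · simp
  have hcl : c (Fin.last m) + descents σ = m := by
    rw [descents_eq]
    have := Finset.card_filter_add_card_filter_not (s := (Finset.univ : Finset (Fin m))) D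
    simp only [Finset.card_univ, Fintype.card_fin] at this
    simp only [hc, Fin.castSucc_lt_last, true_and]
    rw [add_comm]; exact this
  refine ⟨?_, by omega⟩
  have h3 : k + m - descents σ = k + c (Fin.last m) := by omega
  rw [h3, ← count_aux D c c0 cs]
  refine Finset.card_bij (fun w _ => w ∘ σ) ?_ ?_ ?_
  · intro w hw
    simp only [Finset.mem_filter, Finset.mem_univ, true_and] at hw ⊢
    intro i
    rcases (eq_sort_iff_adj w σ).1 hw.symm i with h | h
    · exact Or.inl h
    · exact Or.inr ⟨h.1, not_lt.2 h.2.le⟩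
  · intro w _ w' _ h
    exact σ.surjective.injective_comp_right h
  · intro a ha
    simp only [Finset.mem_filter, Finset.mem_univ, true_and] at ha
    refine ⟨a ∘ σ.symm, ?_, ?_⟩
    · simp only [Finset.mem_filter, Finset.mem_univ, true_and]
      symm
      rw [eq_sort_iff_adj]
      intro i
      simp only [Function.comp_apply, Equiv.symm_apply_apply]
      rcases ha i with h | h
      · exact Or.inl h
      · refine Or.inr ⟨h.1, lt_of_le_of_ne (not_lt.1 h.2) ?_⟩
        intro h'
        exact (Fin.castSucc_lt_succ (i := i)).ne (σ.injective h')
    · funext i; simp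

/-- Sum of the stable sorting permutations of all words of length `n` in the alphabet `α`. -/
def sortSum (n : ℕ) (α : Type*) [Fintype α] [LinearOrder α] :
    MonoidAlgebra ℚ (Equiv.Perm (Fin n)) :=
  ∑ w : Fin n → α, MonoidAlgebra.single (Tuple.sort w) 1

lemma sortSum_congr {n : ℕ} {α β : Type*} [Fintype α] [LinearOrder α] [Fintype β] [LinearOrder β]
    (e : α ≃o β) : sortSum n α = sortSum n β := by
  unfold sortSum
  refine Fintype.sum_equiv (Equiv.arrowCongr (Equiv.refl _) e.toEquiv) _ _ ?_
  intro w
  congr 1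
  rw [Tuple.eq_sort_iff]
  refine ⟨?_, ?_⟩
  · exact e.monotone.comp (Tuple.monotone_sort w)
  · intro i j hij h
    exact (Tuple.eq_sort_iff.1 (rfl : Tuple.sort w = Tuple.sort w)).2 i j hij (e.injective h)

lemma sortSum_mul {n : ℕ} {α β : Type*} [Fintype α] [LinearOrder α] [Fintype β] [LinearOrder β] :
    sortSum n α * sortSum n β = sortSum n (β ×ₗ α) := by
  unfold sortSum
  rw [Finset.sum_mul_sum]
  rw [← Fintype.sum_prod_type']
  let φ : ((Fin n → α) × (Fin n → β)) ≃ (Fin n → β ×ₗ α) :=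
    { toFun := fun p i => toLex (p.2 ((Tuple.sort p.1).symm i), p.1 i)
      invFun := fun v => (fun i => (ofLex (v i)).2,
        fun i => (ofLex (v (Tuple.sort (fun i => (ofLex (v i)).2) i))).1)
      left_inv := by
        rintro ⟨u, w⟩
        simp
      right_inv := by
        intro v
        funext i
        simp }
  refine Fintype.sum_equiv φ _ _ ?_
  rintro ⟨u, w⟩
  rw [MonoidAlgebra.single_mul_single, mul_one]
  congr 1
  obtain ⟨hu1, hu2⟩ := Tuple.eq_sort_iff.1 (rfl : Tuple.sort u = Tuple.sort u)
  obtain ⟨hw1, hw2⟩ := Tuple.eq_sort_iff.1 (rfl : Tuple.sort w = Tuple.sort w)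
  set σ := Tuple.sort u
  set τ := Tuple.sort w
  have hφ : ∀ i, φ (u, w) ((σ * τ) i) = toLex (w (τ i), u (σ (τ i))) := by
    intro i
    simp [φ, σ]
  rw [Tuple.eq_sort_iff]
  refine ⟨?_, ?_⟩
  · intro i j hij
    simp only [Function.comp_apply, hφ]
    rcases hij.eq_or_lt with rfl | hij
    · exact le_rfl
    rw [Prod.Lex.toLex_le_toLex]
    rcases (hw1 hij.le).lt_or_eq with h | h
    · exact Or.inl h
    · exact Or.inr ⟨h, hu1 (hw2 i j hij h).le⟩
  · intro i j hij h
    rw [hφ, hφ] at h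
    have h := Prod.ext_iff.1 (toLex.injective h)
    exact hu2 _ _ (hw2 i j hij h.1) h.2

lemma sortSum_fin_mul (n k l : ℕ) :
    sortSum n (Fin k) * sortSum n (Fin l) = sortSum n (Fin (k * l)) := by
  rw [sortSum_mul]
  refine sortSum_congr (Fintype.orderIsoFinOfCardEq _ ?_).symm
  rw [Fintype.card_congr (ofLex : Fin l ×ₗ Fin k ≃ _)]
  simp [mul_comm]

lemma aCoeff_sum (m k d : ℕ) (hd : d ≤ m) :
    ∑ l ∈ Finset.range (m+2), (k : ℚ)^l * aCoeff (m+1) l (d+1) = ((k + m - d).choose (m+1) : ℚ) := by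
  unfold aCoeff
  set P : Polynomial ℚ := (((m+1).factorial : ℚ))⁻¹ • ∏ i ∈ Finset.Icc 1 (m+1),
    (Polynomial.X + Polynomial.C ((i : ℚ) - ((d + 1 : ℕ) : ℚ))) with hP
  have hdeg : P.natDegree < m + 2 := by
    refine lt_of_le_of_lt (Polynomial.natDegree_smul_le _ _) ?_
    refine lt_of_le_of_lt (Polynomial.natDegree_prod_le _ _) ?_
    simp only [Polynomial.natDegree_X_add_C]
    simp
  have h1 : ∑ l ∈ Finset.range (m+2), (k : ℚ)^l * P.coeff l = P.eval (k : ℚ) := by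
    rw [Polynomial.eval_eq_sum_range' hdeg]
    exact Finset.sum_congr rfl fun _ _ => mul_comm _ _
  rw [h1, hP, Polynomial.eval_smul, Polynomial.eval_prod]
  rw [Nat.choose_eq_descFactorial_div_factorial, Nat.cast_div (Nat.factorial_dvd_descFactorial _ _)
    (by positivity), ← descPochhammer_eval_eq_descFactorial, descPochhammer_eval_eq_prod_range,
    smul_eq_mul, inv_mul_eq_div]
  congr 1
  rw [← Finset.prod_range_reflect, Finset.range_eq_Ico, ← Finset.Ico_add_one_right_eq_Icc,
    Finset.prod_Ico_eq_prod_range, Finset.prod_Ico_eq_prod_range]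
  refine Finset.prod_congr (by simp) fun j hj => ?_
  have hj : j < m + 1 := by simpa using hj
  have e1 : m + 1 - 1 - (0 + j) = m - j := by omega
  rw [e1, Nat.cast_sub (by omega : j ≤ m), Nat.cast_sub (by omega : d ≤ k + m)]
  simp
  ring

lemma sortSum_eq (m k : ℕ) :
    sortSum (m+1) (Fin k) = ∑ l ∈ Finset.range (m+2), (k : ℚ)^l • eul (m+1) l := by
  unfold eul sortSum
  simp only [Finset.smul_sum, MonoidAlgebra.smul_single, smul_eq_mul]
  rw [Finset.sum_comm]
  have h : ∀ σ : Equiv.Perm (Fin (m+1)), ∑ l ∈ Finset.range (m+2),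
      MonoidAlgebra.single σ ((k : ℚ)^l * aCoeff (m+1) l (descents σ + 1)) =
      ∑ w : Fin (m+1) → Fin k with Tuple.sort w = σ, MonoidAlgebra.single (Tuple.sort w) (1 : ℚ) := by
    intro σ
    obtain ⟨h1, h2⟩ := count_sort k σ
    have h3 : ∑ w : Fin (m+1) → Fin k with Tuple.sort w = σ,
        MonoidAlgebra.single (Tuple.sort w) (1 : ℚ) =
        ∑ w : Fin (m+1) → Fin k with Tuple.sort w = σ, MonoidAlgebra.single σ (1 : ℚ) :=
      Finset.sum_congr rfl fun w hw => by rw [(Finset.mem_filter.1 hw).2]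
    rw [h3, Finset.sum_const, h1]
    rw [MonoidAlgebra.smul_single, nsmul_eq_mul, mul_one, ← aCoeff_sum m k _ h2]
    exact (map_sum (MonoidAlgebra.singleAddHom σ) _ _).symm
  simp only [h]
  rw [Finset.sum_fiberwise]

lemma pow_sum_inj {G : Type*} {N : ℕ} (x y : ℕ → MonoidAlgebra ℚ G)
    (h : ∀ k : ℕ, ∑ l ∈ Finset.range N, (k : ℚ)^l • x l = ∑ l ∈ Finset.range N, (k : ℚ)^l • y l) :
    ∀ l < N, x l = y l := by
  intro l hl
  ext g
  let P : (ℕ → MonoidAlgebra ℚ G) → Polynomial ℚ := fun z =>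
    ∑ l ∈ Finset.range N, Polynomial.C ((z l).coeff g) * Polynomial.X ^ l
  have hev : ∀ z (k : ℕ), (P z).eval (k : ℚ) =
      (∑ l ∈ Finset.range N, (k : ℚ)^l • z l).coeff g := by
    intro z k
    simp only [P, Polynomial.eval_finsetSum, MonoidAlgebra.coeff_sum, Finsupp.coe_finsetSum,
      Finset.sum_apply]
    refine Finset.sum_congr rfl fun l _ => ?_
    simp [mul_comm (_ ^ _)]
  have hP : P x = P y := by
    apply Polynomial.eq_of_infinite_eval_eq
    refine (Set.infinite_range_of_injective (Nat.cast_injective (R := ℚ))).mono ?_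
    rintro _ ⟨k, rfl⟩
    simp only [Set.mem_ofPred_eq, hev, h]
  have := congrArg (fun p => p.coeff l) hP
  simpa [P, Polynomial.finsetSum_coeff, Polynomial.coeff_X_pow, hl] using this

lemma eul_idem (m l : ℕ) (hl : l < m + 2) : eul (m+1) l * eul (m+1) l = eul (m+1) l := by
  have h1 : ∀ k : ℕ, eul (m+1) l * sortSum (m+1) (Fin k) = (k : ℚ)^l • eul (m+1) l := by
    intro k
    refine pow_sum_inj (fun l => eul (m+1) l * sortSum (m+1) (Fin k))
      (fun l => (k : ℚ)^l • eul (m+1) l) (N := m+2) ?_ l hl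
    intro j
    have := sortSum_fin_mul (m+1) j k
    rw [sortSum_eq m j, sortSum_eq m (j*k), Finset.sum_mul] at this
    simp only [smul_mul_assoc] at this
    rw [this]
    refine Finset.sum_congr rfl fun r _ => ?_
    rw [smul_smul, Nat.cast_mul, mul_pow]
  have h2 := pow_sum_inj (fun r => eul (m+1) l * eul (m+1) r)
    (fun r => if r = l then eul (m+1) l else 0) (N := m+2) ?_ l hl
  · simpa using h2
  intro k
  have := h1 k
  rw [sortSum_eq, Finset.mul_sum] at this
  simp only [mul_smul_comm] at this
  rw [this]
  simp [hl]

lemma finrank_eq_trace (n i : ℕ) (h : eul n i * eul n i = eul n i) :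
    (Module.finrank ℚ (leftIdeal n i) : ℚ) = n.factorial * (eul n i).coeff 1 := by
  set b := MonoidAlgebra.basis (Equiv.Perm (Fin n)) ℚ
  have : Module.Finite ℚ (MonoidAlgebra ℚ (Equiv.Perm (Fin n))) := Module.Finite.of_basis b
  set f : Module.End ℚ (MonoidAlgebra ℚ (Equiv.Perm (Fin n))) := LinearMap.mulRight ℚ (eul n i)
  have hf : LinearMap.IsProj (leftIdeal n i) f := by
    constructor
    · intro x
      exact Submodule.subset_span ⟨x, rfl⟩
    · intro x hx
      induction hx using Submodule.span_induction with
      | mem x hx =>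
        obtain ⟨y, rfl⟩ := hx
        simp [f, mul_assoc, h]
      | zero => simp
      | add x y _ _ hx hy => rw [map_add, hx, hy]
      | smul a x _ hx => rw [map_smul, hx]
  rw [← hf.trace, LinearMap.trace_eq_matrix_trace ℚ b, Matrix.trace]
  have : ∀ σ, (LinearMap.toMatrix b b f).diag σ = (eul n i).coeff 1 := by
    intro σ
    rw [Matrix.diag_apply, LinearMap.toMatrix_apply]
    simp [b, f, MonoidAlgebra.basis, MonoidAlgebra.coeff_single_mul_apply]
  rw [Finset.sum_congr rfl fun σ _ => this σ]
  simp [Fintype.card_perm]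

/-- The left ideal `ℚ[Sₙ]·ẽ⁽ⁱ⁾ₙ` has `ℚ`-dimension the coefficient of `q^i` in
`q(q+1)⋯(q+n-1)`. -/
theorem finrank_leftIdeal_eulerian (n i : ℕ) (hn : 1 ≤ n) (hi : 1 ≤ i) (hin : i ≤ n) :
    Module.finrank ℚ (leftIdeal n i) =
      ((∏ j ∈ Finset.range n, (Polynomial.X + Polynomial.C j) : Polynomial ℕ)).coeff i := by
  obtain ⟨m, rfl⟩ : ∃ m, n = m + 1 := ⟨n - 1, by omega⟩
  have h := finrank_eq_trace (m+1) i (eul_idem m i (by omega))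
  have h1 : (eul (m+1) i).coeff 1 = aCoeff (m+1) i 1 := by
    have hd : descents (1 : Equiv.Perm (Fin (m+1))) = 0 := by
      rw [descents_eq]
      simp [Fin.lt_def]
    classical
    simp [eul, MonoidAlgebra.coeff_sum, Finsupp.single_apply, hd]
  rw [h1, aCoeff, Polynomial.coeff_smul, smul_eq_mul, mul_inv_cancel_left₀ (by positivity)] at h
  have h2 : (∏ j ∈ Finset.range (m+1), (Polynomial.X + Polynomial.C j) : Polynomial ℕ).map
      (Nat.castRingHom ℚ) = ∏ i ∈ Finset.Icc 1 (m+1),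
        (Polynomial.X + Polynomial.C ((i : ℚ) - ((1 : ℕ) : ℚ))) := by
    rw [Polynomial.map_prod, ← Finset.Ico_add_one_right_eq_Icc, Finset.prod_Ico_eq_prod_range]
    refine Finset.prod_congr (by simp) fun j _ => ?_
    simp
  rw [← h2, Polynomial.coeff_map] at h
  exact Nat.cast_injective (R := ℚ) h
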